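/- There is no function w from the unit vectors of ℝ³ to {0,1} such that for every orthonormal basis {x₁, x₂, x₃} of ℝ³, exactly one of w(x₁), w(x₂), w(x₃) equals 1. -/

import Mathlib

open scoped RealInnerProductSpace

/-- Pairwise orthogonal nonzero vectors: normalising them gives an orthonormal basis. -/
lemma ks_triple (w : EuclideanSpace ℝ (Fin 3) → Bool)
    (hw : ∀ b : OrthonormalBasis (Fin 3) ℝ (EuclideanSpace ℝ (Fin 3)),
        ∃! i : Fin 3, w (b i) = true)
    (v : Fin 3 → EuclideanSpace ℝ (Fin 3)) (h0 : ∀ i, v i ≠ 0)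
    (ho : ∀ i j, i < j → inner ℝ (v i) (v j) = 0) :
    ∃! i : Fin 3, w ((‖v i‖⁻¹ : ℝ) • v i) = true := by
  have ho' : ∀ i j, i ≠ j → inner ℝ (v i) (v j) = 0 := by
    intro i j hij
    rcases lt_or_gt_of_ne hij with h | h
    · exact ho i j h
    · rw [real_inner_comm]; exact ho j i h
  have hon : Orthonormal ℝ (fun i => (‖v i‖⁻¹ : ℝ) • v i) := by
    constructor
    · intro i
      have := norm_ne_zero_iff.mpr (h0 i)
      rw [norm_smul, norm_inv, norm_norm, inv_mul_cancel₀ this]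
    · intro i j hij
      simp [inner_smul_left, inner_smul_right, ho' i j hij]
  have hcard : Fintype.card (Fin 3) = Module.finrank ℝ (EuclideanSpace ℝ (Fin 3)) := by simp
  have hsp : ⊤ ≤ Submodule.span ℝ (Set.range (fun i => (‖v i‖⁻¹ : ℝ) • v i)) :=
    (hon.linearIndependent.span_eq_top_of_card_eq_finrank' hcard).ge
  have := hw (OrthonormalBasis.mk hon hsp)
  simpa using this

/-- The vector with given integer coordinates. -/
noncomputable def ksVec (a b c : ℤ) : EuclideanSpace ℝ (Fin 3) := !₂[(a : ℝ), (b : ℝ), (c : ℝ)]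

/-- The colour of the ray through an integer vector. -/
def ksCol (w : EuclideanSpace ℝ (Fin 3) → Bool) (a b c : ℤ) : Prop :=
  w ((‖ksVec a b c‖⁻¹ : ℝ) • ksVec a b c) = true

lemma ksVec_ne {a b c : ℤ} (h : ¬ (a = 0 ∧ b = 0 ∧ c = 0)) : ksVec a b c ≠ 0 := by
  intro h'
  apply h
  have h1 := congrArg (fun x : EuclideanSpace ℝ (Fin 3) => x 0) h'
  have h2 := congrArg (fun x : EuclideanSpace ℝ (Fin 3) => x 1) h'
  have h3 := congrArg (fun x : EuclideanSpace ℝ (Fin 3) => x 2) h'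
  simp [ksVec] at h1 h2 h3
  exact ⟨h1, h2, h3⟩

lemma ksVec_inner {a b c x y z : ℤ} (h : a * x + b * y + c * z = 0) :
    inner ℝ (ksVec a b c) (ksVec x y z) = 0 := by
  have h' : (a : ℝ) * x + b * y + c * z = 0 := by exact_mod_cast h
  simp [ksVec, PiLp.inner_apply, Fin.sum_univ_three]
  linarith

lemma ksCol_unique (w : EuclideanSpace ℝ (Fin 3) → Bool)
    (hw : ∀ b : OrthonormalBasis (Fin 3) ℝ (EuclideanSpace ℝ (Fin 3)),
        ∃! i : Fin 3, w (b i) = true) (a b c x y z p q r : ℤ)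
    (h1 : ¬ (a = 0 ∧ b = 0 ∧ c = 0)) (h2 : ¬ (x = 0 ∧ y = 0 ∧ z = 0))
    (h3 : ¬ (p = 0 ∧ q = 0 ∧ r = 0)) (h12 : a * x + b * y + c * z = 0)
    (h13 : a * p + b * q + c * r = 0) (h23 : x * p + y * q + z * r = 0) :
    (ksCol w a b c ∨ ksCol w x y z ∨ ksCol w p q r) ∧ ¬ (ksCol w a b c ∧ ksCol w x y z) := by
  have key := ks_triple w hw ![ksVec a b c, ksVec x y z, ksVec p q r]
    (by intro i; fin_cases i
        · exact ksVec_ne h1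
        · exact ksVec_ne h2
        · exact ksVec_ne h3)
    (by intro i j hij
        fin_cases i <;> fin_cases j <;> first
          | exact ksVec_inner h12
          | exact ksVec_inner h13
          | exact ksVec_inner h23
          | exact absurd hij (by decide))
  obtain ⟨i, hi, hu⟩ := key
  constructor
  · fin_cases i
    · exact Or.inl hi
    · exact Or.inr (Or.inl hi)
    · exact Or.inr (Or.inr hi)
  · rintro ⟨ha, hb⟩
    have e0 := hu 0 ha
    have e1 := hu 1 hb
    exact absurd (e0.trans e1.symm) (by decide)

lemma ksCol_pair (w : EuclideanSpace ℝ (Fin 3) → Bool)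
    (hw : ∀ b : OrthonormalBasis (Fin 3) ℝ (EuclideanSpace ℝ (Fin 3)),
        ∃! i : Fin 3, w (b i) = true) (a b c x y z : ℤ)
    (h1 : ¬ (a = 0 ∧ b = 0 ∧ c = 0)) (h2 : ¬ (x = 0 ∧ y = 0 ∧ z = 0))
    (h12 : a * x + b * y + c * z = 0) (ha : ksCol w a b c) (hb : ksCol w x y z) : False := by
  refine (ksCol_unique w hw a b c x y z (b * z - c * y) (c * x - a * z) (a * y - b * x)
    h1 h2 ?_ h12 (by ring) (by ring)).2 ⟨ha, hb⟩
  rintro ⟨e1, e2, e3⟩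
  have hl : (a ^ 2 + b ^ 2 + c ^ 2) * (x ^ 2 + y ^ 2 + z ^ 2) = 0 := by
    have : (a ^ 2 + b ^ 2 + c ^ 2) * (x ^ 2 + y ^ 2 + z ^ 2) = (a * x + b * y + c * z) ^ 2 +
      (b * z - c * y) ^ 2 + (c * x - a * z) ^ 2 + (a * y - b * x) ^ 2 := by ring
    rw [this, h12, e1, e2, e3]; ring
  have sq0 : ∀ s t u : ℤ, s ^ 2 + t ^ 2 + u ^ 2 = 0 → s = 0 ∧ t = 0 ∧ u = 0 := by
    intro s t u h
    refine ⟨?_, ?_, ?_⟩ <;> apply pow_eq_zero_iff (two_ne_zero) |>.mp <;> nlinarith [sq_nonneg s, sq_nonneg t, sq_nonneg u]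
  rcases mul_eq_zero.mp hl with h | h
  · exact h1 (sq0 _ _ _ h)
  · exact h2 (sq0 _ _ _ h)

/-- The finite combinatorial core: the integer rays with coordinates in `{-2,…,2}` admit no
Kochen–Specker colouring. -/
lemma ks_core (C : ℤ → ℤ → ℤ → Prop)
    (P : ∀ a b c x y z : ℤ, C a b c → C x y z →
      (h1 : ¬ (a = 0 ∧ b = 0 ∧ c = 0) := by decide) →
      (h2 : ¬ (x = 0 ∧ y = 0 ∧ z = 0) := by decide) →
      (h12 : a * x + b * y + c * z = 0 := by decide) → False)
    (T : ∀ a b c x y z p q r : ℤ,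
      (h1 : ¬ (a = 0 ∧ b = 0 ∧ c = 0) := by decide) →
      (h2 : ¬ (x = 0 ∧ y = 0 ∧ z = 0) := by decide) →
      (h3 : ¬ (p = 0 ∧ q = 0 ∧ r = 0) := by decide) →
      (h12 : a * x + b * y + c * z = 0 := by decide) →
      (h13 : a * p + b * q + c * r = 0 := by decide) →
      (h23 : x * p + y * q + z * r = 0 := by decide) →
      C a b c ∨ C x y z ∨ C p q r) : False := by
  rcases T 0 0 1 0 1 0 1 0 0 with t_ooa | t_oao | t_aoo
  · have f_aoo : ¬ C 1 0 0 := fun h => P 0 0 1 1 0 0 t_ooa h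
    rcases T 0 1 (-1) 0 1 1 1 0 0 with t_oam | t_oaa | h
    · have f_oao : ¬ C 0 1 0 := fun h => P 0 0 1 0 1 0 t_ooa h
      have f_amo : ¬ C 1 (-1) 0 := fun h => P 0 0 1 1 (-1) 0 t_ooa h
      have f_aao : ¬ C 1 1 0 := fun h => P 0 0 1 1 1 0 t_ooa h
      have f_oaa : ¬ C 0 1 1 := fun h => P 0 1 (-1) 0 1 1 t_oam h
      have f_amm : ¬ C 1 (-1) (-1) := fun h => P 0 1 (-1) 1 (-1) (-1) t_oam h
      have f_aaa : ¬ C 1 1 1 := fun h => P 0 1 (-1) 1 1 1 t_oam h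
      have t_amb : C 1 (-1) 2 := by
        simpa [f_amm, f_aao] using T 1 (-1) (-1) 1 (-1) 2 1 1 0
      have t_aan : C 1 1 (-2) := by
        simpa [f_amo, f_aaa] using T 1 (-1) 0 1 1 (-2) 1 1 1
      have f_bom : ¬ C 2 0 (-1) := fun h => P 1 (-1) 2 2 0 (-1) t_amb h
      have t_aob : C 1 0 2 := by
        simpa [f_oao, f_bom] using T 0 1 0 1 0 2 2 0 (-1)
      have f_boa : ¬ C 2 0 1 := fun h => P 1 1 (-2) 2 0 1 t_aan h
      have t_aon : C 1 0 (-2) := by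
        simpa [f_oao, f_boa] using T 0 1 0 1 0 (-2) 2 0 1
      have f_bam : ¬ C 2 1 (-1) := fun h => P 1 0 2 2 1 (-1) t_aob h
      have t_ama : C 1 (-1) 1 := by
        simpa [f_oaa, f_bam] using T 0 1 1 1 (-1) 1 2 1 (-1)
      have f_bma : ¬ C 2 (-1) 1 := fun h => P 1 0 (-2) 2 (-1) 1 t_aon h
      have t_aam : C 1 1 (-1) := by
        simpa [f_oaa, f_bma] using T 0 1 1 1 1 (-1) 2 (-1) 1
      have f_aom : ¬ C 1 0 (-1) := fun h => P 1 (-1) 1 1 0 (-1) t_ama h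
      have t_aoa : C 1 0 1 := by
        simpa [f_oao, f_aom] using T 0 1 0 1 0 (-1) 1 0 1
      exact P 1 1 (-1) 1 0 1 t_aam t_aoa
    · have f_oao : ¬ C 0 1 0 := fun h => P 0 0 1 0 1 0 t_ooa h
      have f_amo : ¬ C 1 (-1) 0 := fun h => P 0 0 1 1 (-1) 0 t_ooa h
      have f_aao : ¬ C 1 1 0 := fun h => P 0 0 1 1 1 0 t_ooa h
      have f_oam : ¬ C 0 1 (-1) := fun h => P 0 1 1 0 1 (-1) t_oaa h
      have f_ama : ¬ C 1 (-1) 1 := fun h => P 0 1 1 1 (-1) 1 t_oaa h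
      have f_aam : ¬ C 1 1 (-1) := fun h => P 0 1 1 1 1 (-1) t_oaa h
      have t_amn : C 1 (-1) (-2) := by
        simpa [f_ama, f_aao] using T 1 (-1) (-2) 1 (-1) 1 1 1 0
      have t_aab : C 1 1 2 := by
        simpa [f_amo, f_aam] using T 1 (-1) 0 1 1 (-1) 1 1 2
      have f_boa : ¬ C 2 0 1 := fun h => P 1 (-1) (-2) 2 0 1 t_amn h
      have t_aon : C 1 0 (-2) := by
        simpa [f_oao, f_boa] using T 0 1 0 1 0 (-2) 2 0 1
      have f_bom : ¬ C 2 0 (-1) := fun h => P 1 1 2 2 0 (-1) t_aab h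
      have t_aob : C 1 0 2 := by
        simpa [f_oao, f_bom] using T 0 1 0 1 0 2 2 0 (-1)
      have f_baa : ¬ C 2 1 1 := fun h => P 1 0 (-2) 2 1 1 t_aon h
      have t_amm : C 1 (-1) (-1) := by
        simpa [f_oam, f_baa] using T 0 1 (-1) 1 (-1) (-1) 2 1 1
      have f_bmm : ¬ C 2 (-1) (-1) := fun h => P 1 0 2 2 (-1) (-1) t_aob h
      have t_aaa : C 1 1 1 := by
        simpa [f_oam, f_bmm] using T 0 1 (-1) 1 1 1 2 (-1) (-1)
      have f_aoa : ¬ C 1 0 1 := fun h => P 1 (-1) (-1) 1 0 1 t_amm h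
      have t_aom : C 1 0 (-1) := by
        simpa [f_oao, f_aoa] using T 0 1 0 1 0 (-1) 1 0 1
      exact P 1 1 1 1 0 (-1) t_aaa t_aom
    · exact f_aoo h
  · have f_ooa : ¬ C 0 0 1 := fun h => P 0 1 0 0 0 1 t_oao h
    rcases T 0 0 1 1 (-1) 0 1 1 0 with h | t_amo | t_aao
    · exact f_ooa h
    · have f_aom : ¬ C 1 0 (-1) := fun h => P 0 1 0 1 0 (-1) t_oao h
      have f_aoo : ¬ C 1 0 0 := fun h => P 0 1 0 1 0 0 t_oao h
      have f_aoa : ¬ C 1 0 1 := fun h => P 0 1 0 1 0 1 t_oao h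
      have f_aam : ¬ C 1 1 (-1) := fun h => P 1 (-1) 0 1 1 (-1) t_amo h
      have f_aaa : ¬ C 1 1 1 := fun h => P 1 (-1) 0 1 1 1 t_amo h
      have f_bbm : ¬ C 2 2 (-1) := fun h => P 1 (-1) 0 2 2 (-1) t_amo h
      have f_bba : ¬ C 2 2 1 := fun h => P 1 (-1) 0 2 2 1 t_amo h
      have t_anm : C 1 (-2) (-1) := by
        simpa [f_aoa, f_aam] using T 1 (-2) (-1) 1 0 1 1 1 (-1)
      have t_ana : C 1 (-2) 1 := by
        simpa [f_aom, f_aaa] using T 1 (-2) 1 1 0 (-1) 1 1 1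
      have f_oan : ¬ C 0 1 (-2) := fun h => P 1 (-2) (-1) 0 1 (-2) t_anm h
      have t_oba : C 0 2 1 := by
        simpa [f_oan, f_aoo] using T 0 1 (-2) 0 2 1 1 0 0
      have f_oab : ¬ C 0 1 2 := fun h => P 1 (-2) 1 0 1 2 t_ana h
      have t_obm : C 0 2 (-1) := by
        simpa [f_oab, f_aoo] using T 0 1 2 0 2 (-1) 1 0 0
      have f_bmb : ¬ C 2 (-1) 2 := fun h => P 0 2 1 2 (-1) 2 t_oba h
      have t_ann : C 1 (-2) (-2) := by
        simpa [f_bmb, f_bbm] using T 1 (-2) (-2) 2 (-1) 2 2 2 (-1)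
      have f_bmn : ¬ C 2 (-1) (-2) := fun h => P 0 2 (-1) 2 (-1) (-2) t_obm h
      have t_anb : C 1 (-2) 2 := by
        simpa [f_bmn, f_bba] using T 1 (-2) 2 2 (-1) (-2) 2 2 1
      have f_oam : ¬ C 0 1 (-1) := fun h => P 1 (-2) (-2) 0 1 (-1) t_ann h
      have t_oaa : C 0 1 1 := by
        simpa [f_oam, f_aoo] using T 0 1 (-1) 0 1 1 1 0 0
      exact P 1 (-2) 2 0 1 1 t_anb t_oaa
    · have f_aom : ¬ C 1 0 (-1) := fun h => P 0 1 0 1 0 (-1) t_oao h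
      have f_aoo : ¬ C 1 0 0 := fun h => P 0 1 0 1 0 0 t_oao h
      have f_aoa : ¬ C 1 0 1 := fun h => P 0 1 0 1 0 1 t_oao h
      have f_amm : ¬ C 1 (-1) (-1) := fun h => P 1 1 0 1 (-1) (-1) t_aao h
      have f_amo : ¬ C 1 (-1) 0 := fun h => P 1 1 0 1 (-1) 0 t_aao h
      have f_ama : ¬ C 1 (-1) 1 := fun h => P 1 1 0 1 (-1) 1 t_aao h
      have t_abm : C 1 2 (-1) := by
        simpa [f_amm, f_aoa] using T 1 (-1) (-1) 1 0 1 1 2 (-1)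
      have t_aba : C 1 2 1 := by
        simpa [f_ama, f_aom] using T 1 (-1) 1 1 0 (-1) 1 2 1
      have f_oab : ¬ C 0 1 2 := fun h => P 1 2 (-1) 0 1 2 t_abm h
      have t_obm : C 0 2 (-1) := by
        simpa [f_oab, f_aoo] using T 0 1 2 0 2 (-1) 1 0 0
      have f_oan : ¬ C 0 1 (-2) := fun h => P 1 2 1 0 1 (-2) t_aba h
      have t_oba : C 0 2 1 := by
        simpa [f_oan, f_aoo] using T 0 1 (-2) 0 2 1 1 0 0
      have f_aab : ¬ C 1 1 2 := fun h => P 0 2 (-1) 1 1 2 t_obm h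
      have t_aam : C 1 1 (-1) := by
        simpa [f_amo, f_aab] using T 1 (-1) 0 1 1 (-1) 1 1 2
      have f_aan : ¬ C 1 1 (-2) := fun h => P 0 2 1 1 1 (-2) t_oba h
      have t_aaa : C 1 1 1 := by
        simpa [f_amo, f_aan] using T 1 (-1) 0 1 1 (-2) 1 1 1
      have f_oaa : ¬ C 0 1 1 := fun h => P 1 1 (-1) 0 1 1 t_aam h
      have t_oam : C 0 1 (-1) := by
        simpa [f_oaa, f_aoo] using T 0 1 (-1) 0 1 1 1 0 0
      exact P 1 1 1 0 1 (-1) t_aaa t_oam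
  · have f_ooa : ¬ C 0 0 1 := fun h => P 1 0 0 0 0 1 t_aoo h
    rcases T 0 0 1 1 (-1) 0 1 1 0 with h | t_amo | t_aao
    · exact f_ooa h
    · have f_oam : ¬ C 0 1 (-1) := fun h => P 1 0 0 0 1 (-1) t_aoo h
      have f_oao : ¬ C 0 1 0 := fun h => P 1 0 0 0 1 0 t_aoo h
      have f_oaa : ¬ C 0 1 1 := fun h => P 1 0 0 0 1 1 t_aoo h
      have f_aam : ¬ C 1 1 (-1) := fun h => P 1 (-1) 0 1 1 (-1) t_amo h
      have f_aaa : ¬ C 1 1 1 := fun h => P 1 (-1) 0 1 1 1 t_amo h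
      have f_bbm : ¬ C 2 2 (-1) := fun h => P 1 (-1) 0 2 2 (-1) t_amo h
      have f_bba : ¬ C 2 2 1 := fun h => P 1 (-1) 0 2 2 1 t_amo h
      have t_bmm : C 2 (-1) (-1) := by
        simpa [f_oam, f_aaa] using T 0 1 (-1) 1 1 1 2 (-1) (-1)
      have t_bma : C 2 (-1) 1 := by
        simpa [f_oaa, f_aam] using T 0 1 1 1 1 (-1) 2 (-1) 1
      have f_aob : ¬ C 1 0 2 := fun h => P 2 (-1) (-1) 1 0 2 t_bmm h
      have t_bom : C 2 0 (-1) := by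
        simpa [f_oao, f_aob] using T 0 1 0 1 0 2 2 0 (-1)
      have f_aon : ¬ C 1 0 (-2) := fun h => P 2 (-1) 1 1 0 (-2) t_bma h
      have t_boa : C 2 0 1 := by
        simpa [f_oao, f_aon] using T 0 1 0 1 0 (-2) 2 0 1
      have f_anb : ¬ C 1 (-2) 2 := fun h => P 2 0 (-1) 1 (-2) 2 t_bom h
      have t_bmn : C 2 (-1) (-2) := by
        simpa [f_anb, f_bba] using T 1 (-2) 2 2 (-1) (-2) 2 2 1
      have f_ann : ¬ C 1 (-2) (-2) := fun h => P 2 0 1 1 (-2) (-2) t_boa h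
      have t_bmb : C 2 (-1) 2 := by
        simpa [f_ann, f_bbm] using T 1 (-2) (-2) 2 (-1) 2 2 2 (-1)
      have f_aoa : ¬ C 1 0 1 := fun h => P 2 (-1) (-2) 1 0 1 t_bmn h
      have t_aom : C 1 0 (-1) := by
        simpa [f_oao, f_aoa] using T 0 1 0 1 0 (-1) 1 0 1
      exact P 2 (-1) 2 1 0 (-1) t_bmb t_aom
    · have f_oam : ¬ C 0 1 (-1) := fun h => P 1 0 0 0 1 (-1) t_aoo h
      have f_oao : ¬ C 0 1 0 := fun h => P 1 0 0 0 1 0 t_aoo h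
      have f_oaa : ¬ C 0 1 1 := fun h => P 1 0 0 0 1 1 t_aoo h
      have f_amm : ¬ C 1 (-1) (-1) := fun h => P 1 1 0 1 (-1) (-1) t_aao h
      have f_amo : ¬ C 1 (-1) 0 := fun h => P 1 1 0 1 (-1) 0 t_aao h
      have f_ama : ¬ C 1 (-1) 1 := fun h => P 1 1 0 1 (-1) 1 t_aao h
      have t_baa : C 2 1 1 := by
        simpa [f_oam, f_amm] using T 0 1 (-1) 1 (-1) (-1) 2 1 1
      have t_bam : C 2 1 (-1) := by
        simpa [f_oaa, f_ama] using T 0 1 1 1 (-1) 1 2 1 (-1)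
      have f_aon : ¬ C 1 0 (-2) := fun h => P 2 1 1 1 0 (-2) t_baa h
      have t_boa : C 2 0 1 := by
        simpa [f_oao, f_aon] using T 0 1 0 1 0 (-2) 2 0 1
      have f_aob : ¬ C 1 0 2 := fun h => P 2 1 (-1) 1 0 2 t_bam h
      have t_bom : C 2 0 (-1) := by
        simpa [f_oao, f_aob] using T 0 1 0 1 0 2 2 0 (-1)
      have f_aan : ¬ C 1 1 (-2) := fun h => P 2 0 1 1 1 (-2) t_boa h
      have t_aaa : C 1 1 1 := by
        simpa [f_amo, f_aan] using T 1 (-1) 0 1 1 (-2) 1 1 1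
      have f_aab : ¬ C 1 1 2 := fun h => P 2 0 (-1) 1 1 2 t_bom h
      have t_aam : C 1 1 (-1) := by
        simpa [f_amo, f_aab] using T 1 (-1) 0 1 1 (-1) 1 1 2
      have f_aom : ¬ C 1 0 (-1) := fun h => P 1 1 1 1 0 (-1) t_aaa h
      have t_aoa : C 1 0 1 := by
        simpa [f_oao, f_aom] using T 0 1 0 1 0 (-1) 1 0 1
      exact P 1 1 (-1) 1 0 1 t_aam t_aoa

/-- Kochen–Specker theorem in dimension 3: there is no `{0,1}`-coloring of the
unit vectors of `ℝ³` assigning the value 1 to exactly one member of every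
orthonormal basis. -/
theorem kochen_specker_dim_three :
    ¬ ∃ w : EuclideanSpace ℝ (Fin 3) → Bool,
      ∀ b : OrthonormalBasis (Fin 3) ℝ (EuclideanSpace ℝ (Fin 3)),
        ∃! i : Fin 3, w (b i) = true := by
  rintro ⟨w, hw⟩
  exact ks_core (ksCol w)
    (fun a b c x y z ha hb h1 h2 h12 => ksCol_pair w hw a b c x y z h1 h2 h12 ha hb)
    (fun a b c x y z p q r h1 h2 h3 h12 h13 h23 =>
      (ksCol_unique w hw a b c x y z p q r h1 h2 h3 h12 h13 h23).1)
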